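/- Let (f_n)_{n ∈ ℕ} be a sequence of unit vectors in a Hilbert space H such that ∑_{k=0}^∞ |⟨f_j, f_k⟩| ≤ B for every j ∈ ℕ, for some constant B > 0, and let m ≥ 1 satisfy (B − 1)/2^m < 1. Then ℕ can be partitioned into 2^m subsets I_1, …, I_{2^m} such that for each p, sup_{j ∈ I_p} ∑_{i ∈ I_p, i ≠ j} |⟨f_i, f_j⟩| ≤ (B − 1)/2^m < 1, and consequently each subsequence (f_n)_{n ∈ I_p} is a Riesz sequence. -/

import Mathlib

open scoped InnerProductSpace

section Coloring

variable {ι κ : Type*} [DecidableEq κ]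

/-- The total weight of the monochromatic ordered pairs of `s` under the coloring `P`. -/
def monochromaticWeight (w : ι → ι → ℝ) (s : Finset ι) (P : ι → κ) : ℝ :=
  ∑ i ∈ s, ∑ k ∈ s, if P i = P k then w i k else 0

lemma monochromaticWeight_insert [DecidableEq ι] {w : ι → ι → ℝ} (hsymm : ∀ i k, w i k = w k i)
    (hdiag : ∀ i, w i i = 0) {t : Finset ι} {j : ι} (hj : j ∉ t) (P : ι → κ) :
    monochromaticWeight w (insert j t) P =
      2 * (∑ i ∈ t, if P i = P j then w i j else 0) + monochromaticWeight w t P := by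
  have hswap : ∀ k, (if P j = P k then w j k else 0) = if P k = P j then w k j else 0 := by
    intro k
    rw [hsymm j k]
    simp only [eq_comm]
  simp only [monochromaticWeight, Finset.sum_insert hj, Finset.sum_add_distrib, hdiag, ite_self,
    hswap]
  ring

lemma monochromaticWeight_congr {w : ι → ι → ℝ} {s : Finset ι} {P Q : ι → κ}
    (h : ∀ i ∈ s, P i = Q i) : monochromaticWeight w s P = monochromaticWeight w s Q := by
  refine Finset.sum_congr rfl fun i hi => Finset.sum_congr rfl fun k hk => ?_
  rw [h i hi, h k hk]

lemma continuous_ite_color_eq [TopologicalSpace κ] [DiscreteTopology κ] (i k : ι) (a : ℝ) :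
    Continuous fun P : ι → κ => if P i = P k then a else 0 := by
  have h : Continuous fun x : κ × κ => if x.1 = x.2 then a else 0 := continuous_of_discreteTopology
  have hpair : Continuous fun P : ι → κ => (P i, P k) := by fun_prop
  exact h.comp hpair

/-- A coloring of minimal monochromatic weight: at each vertex of `s`, the weight towards its own
color class is at most the average over all colors. -/
lemma exists_coloring_finset [Fintype κ] [Nonempty κ] {w : ι → ι → ℝ}
    (hsymm : ∀ i k, w i k = w k i) (hdiag : ∀ i, w i i = 0) (s : Finset ι) :
    ∃ P : ι → κ, ∀ j ∈ s,
      Fintype.card κ * (∑ i ∈ s, if P i = P j then w i j else 0) ≤ ∑ i ∈ s, w i j := by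
  classical
  let : TopologicalSpace κ := ⊥
  have : DiscreteTopology κ := ⟨rfl⟩
  have hcont : Continuous (monochromaticWeight (κ := κ) w s) :=
    continuous_finsetSum _ fun i _ => continuous_finsetSum _ fun k _ =>
      continuous_ite_color_eq i k (w i k)
  obtain ⟨P, -, hP⟩ := isCompact_univ.exists_isMinOn Set.univ_nonempty hcont.continuousOn
  refine ⟨P, fun j hj => ?_⟩
  obtain ⟨t, hjt, rfl⟩ : ∃ t, j ∉ t ∧ insert j t = s :=
    ⟨s.erase j, Finset.notMem_erase j s, Finset.insert_erase hj⟩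
  simp only [Finset.sum_insert hjt, hdiag, ite_self, zero_add]
  have hne : ∀ i ∈ t, i ≠ j := fun i hi h => hjt (h ▸ hi)
  have hmin : ∀ q : κ, (∑ i ∈ t, if P i = P j then w i j else 0) ≤
      ∑ i ∈ t, if P i = q then w i j else 0 := by
    intro q
    have hupdate : (∑ i ∈ t, if Function.update P j q i = Function.update P j q j then w i j else 0)
        = ∑ i ∈ t, if P i = q then w i j else 0 :=
      Finset.sum_congr rfl fun i hi => by
        rw [Function.update_of_ne (hne i hi), Function.update_self]
    have h := isMinOn_iff.1 hP (Function.update P j q) (Set.mem_univ _)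
    rw [monochromaticWeight_insert hsymm hdiag hjt, monochromaticWeight_insert hsymm hdiag hjt,
      monochromaticWeight_congr (P := Function.update P j q) (Q := P)
        fun i hi => Function.update_of_ne (hne i hi) _ _,
      hupdate] at h
    linarith
  calc Fintype.card κ * (∑ i ∈ t, if P i = P j then w i j else 0)
      = ∑ _q : κ, ∑ i ∈ t, if P i = P j then w i j else 0 := by simp
    _ ≤ ∑ q : κ, ∑ i ∈ t, if P i = q then w i j else 0 :=
        Finset.sum_le_sum fun q _ => hmin q
    _ = ∑ i ∈ t, w i j := by
        rw [Finset.sum_comm]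
        simp

/-- The infinite version of `exists_coloring_finset`, by compactness of the space of colorings. -/
lemma exists_coloring [Fintype κ] [Nonempty κ] {w : ι → ι → ℝ} (hnonneg : ∀ i k, 0 ≤ w i k)
    (hsymm : ∀ i k, w i k = w k i) (hdiag : ∀ i, w i i = 0) {C : ℝ}
    (hC : ∀ j, ∀ s : Finset ι, ∑ i ∈ s, w i j ≤ C) :
    ∃ P : ι → κ, ∀ j, ∀ s : Finset ι,
      Fintype.card κ * (∑ i ∈ s, if P i = P j then w i j else 0) ≤ C := by
  classical
  let : TopologicalSpace κ := ⊥
  have : DiscreteTopology κ := ⟨rfl⟩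
  let good : Finset ι → Set (ι → κ) := fun s =>
    {P | ∀ j ∈ s, Fintype.card κ * (∑ i ∈ s, if P i = P j then w i j else 0) ≤ C}
  have hclosed : ∀ s, IsClosed (good s) := by
    intro s
    simp only [good, Set.ofPred_forall]
    exact isClosed_biInter fun j _ => isClosed_le (continuous_const.mul
      (continuous_finsetSum _ fun i _ => continuous_ite_color_eq i j (w i j))) continuous_const
  have hmono : ∀ s t, s ⊆ t → good t ⊆ good s := by
    intro s t hst P hP j hj
    refine le_trans ?_ (hP j (hst hj))
    gcongr
    intro i _ _
    split_ifs
    exacts [hnonneg i j, le_rfl]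
  obtain ⟨P, hP⟩ := IsCompact.nonempty_iInter_of_directed_nonempty_isCompact_isClosed good
    (fun s t => ⟨s ∪ t, hmono _ _ Finset.subset_union_left, hmono _ _ Finset.subset_union_right⟩)
    (fun s => (exists_coloring_finset hsymm hdiag s).imp fun P hP j hj => (hP j hj).trans (hC j s))
    (fun s => (hclosed s).isCompact) hclosed
  refine ⟨P, fun j s => ?_⟩
  have h := Set.mem_iInter.1 hP (insert j s) j (Finset.mem_insert_self j s)
  refine le_trans ?_ h
  gcongr
  · intro i _ _
    split_ifs
    exacts [hnonneg i j, le_rfl]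
  · exact Finset.subset_insert j s

end Coloring

/-- Schur's test for the off-diagonal part of the Gram matrix of finitely many unit vectors. -/
lemma abs_norm_sum_smul_sq_sub_le {𝕜 H ι : Type*} [RCLike 𝕜] [NormedAddCommGroup H]
    [InnerProductSpace 𝕜 H] [DecidableEq ι] {f : ι → H} {s : Finset ι}
    (hunit : ∀ i ∈ s, ‖f i‖ = 1) {δ : ℝ}
    (hδ : ∀ j ∈ s, ∑ i ∈ s.erase j, ‖inner 𝕜 (f i) (f j)‖ ≤ δ) (c : ι → 𝕜) :
    |‖∑ k ∈ s, c k • f k‖ ^ 2 - ∑ k ∈ s, ‖c k‖ ^ 2| ≤ δ * ∑ k ∈ s, ‖c k‖ ^ 2 := by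
  let G : ι → ι → 𝕜 := fun j i => inner 𝕜 (c i • f i) (c j • f j)
  have hG : ∀ j i, ‖G j i‖ = ‖c i‖ * ‖c j‖ * ‖inner 𝕜 (f i) (f j)‖ := by
    intro j i
    simp only [G, inner_smul_left, inner_smul_right, norm_mul, RCLike.norm_conj]
    ring
  have hexp : ((‖∑ k ∈ s, c k • f k‖ ^ 2 - ∑ k ∈ s, ‖c k‖ ^ 2 : ℝ) : 𝕜) =
      ∑ j ∈ s, ∑ i ∈ s.erase j, G j i := by
    have hdiag : ∀ j ∈ s, G j j = ((‖c j‖ ^ 2 : ℝ) : 𝕜) := by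
      intro j hj
      simp only [G, inner_self_eq_norm_sq_to_K, norm_smul, hunit j hj, mul_one]
      push_cast
      rfl
    have hsq : ((‖∑ k ∈ s, c k • f k‖ ^ 2 : ℝ) : 𝕜) = ∑ j ∈ s, ∑ i ∈ s, G j i := by
      push_cast
      rw [← inner_self_eq_norm_sq_to_K, inner_sum]
      exact Finset.sum_congr rfl fun j _ => sum_inner _ _ _
    rw [RCLike.ofReal_sub, hsq, RCLike.ofReal_sum, ← Finset.sum_sub_distrib]
    refine Finset.sum_congr rfl fun j hj => ?_
    rw [← Finset.add_sum_erase s _ hj, hdiag j hj, add_sub_cancel_left]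
  have hcomm : ∑ j ∈ s, ∑ i ∈ s.erase j, ‖c i‖ ^ 2 * ‖inner 𝕜 (f i) (f j)‖ =
      ∑ j ∈ s, ∑ i ∈ s.erase j, ‖c j‖ ^ 2 * ‖inner 𝕜 (f i) (f j)‖ := by
    rw [Finset.sum_comm' (t' := s) (s' := fun i => s.erase i)]
    · exact Finset.sum_congr rfl fun i _ => Finset.sum_congr rfl fun j _ => by
        rw [norm_inner_symm]
    · intro j i
      simp only [Finset.mem_erase]
      tauto
  have hdiagonal : ∑ j ∈ s, ∑ i ∈ s.erase j, ‖c j‖ ^ 2 * ‖inner 𝕜 (f i) (f j)‖ ≤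
      δ * ∑ k ∈ s, ‖c k‖ ^ 2 := by
    rw [Finset.mul_sum]
    refine Finset.sum_le_sum fun j hj => ?_
    rw [← Finset.mul_sum, mul_comm δ]
    exact mul_le_mul_of_nonneg_left (hδ j hj) (sq_nonneg _)
  have hAMGM : ∑ j ∈ s, ∑ i ∈ s.erase j, 2 * ‖G j i‖ ≤
      ∑ j ∈ s, ∑ i ∈ s.erase j, (‖c i‖ ^ 2 * ‖inner 𝕜 (f i) (f j)‖ +
        ‖c j‖ ^ 2 * ‖inner 𝕜 (f i) (f j)‖) := by
    refine Finset.sum_le_sum fun j _ => Finset.sum_le_sum fun i _ => ?_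
    rw [hG, ← add_mul, ← mul_assoc]
    gcongr
    linarith [two_mul_le_add_sq ‖c i‖ ‖c j‖]
  simp only [Finset.sum_add_distrib, ← Finset.mul_sum] at hAMGM
  rw [← RCLike.norm_ofReal (K := 𝕜), hexp]
  have htri : ‖∑ j ∈ s, ∑ i ∈ s.erase j, G j i‖ ≤ ∑ j ∈ s, ∑ i ∈ s.erase j, ‖G j i‖ :=
    (norm_sum_le _ _).trans (Finset.sum_le_sum fun j _ => norm_sum_le _ _)
  simp only [← Finset.mul_sum] at hcomm hdiagonal
  linarith

/-- **Theorem (Gavruta), quantitative form.** Let `(f n)` be a sequence of unit vectors in a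
Hilbert space with `∑_k |⟨f j, f k⟩| ≤ B` for all `j` (via finite partial sums), and let
`m ≥ 1` satisfy `(B − 1)/2^m < 1`.  Then `ℕ` can be partitioned into `2^m` sets (fibers of
`P : ℕ → Fin (2^m)`) such that on each piece `p`,
`sup_{j ∈ I_p} ∑_{i ∈ I_p, i ≠ j} |⟨f i, f j⟩| ≤ (B − 1)/2^m < 1`, and consequently each
subsequence `(f n)_{n ∈ I_p}` is a Riesz sequence. -/
theorem feichtinger_stmt8
    {H : Type*} [NormedAddCommGroup H] [InnerProductSpace ℂ H] [CompleteSpace H]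
    (f : ℕ → H)
    (hunit : ∀ n, ‖f n‖ = 1)
    (B : ℝ) (hB : 0 < B)
    (hSchur : ∀ j : ℕ, ∀ s : Finset ℕ, ∑ k ∈ s, ‖⟪f j, f k⟫_ℂ‖ ≤ B)
    (m : ℕ) (hm : 1 ≤ m) (hlt : (B - 1) / 2 ^ m < 1) :
    ∃ P : ℕ → Fin (2 ^ m), ∀ p : Fin (2 ^ m),
      (∀ j : ℕ, P j = p → ∀ s : Finset ℕ, (∀ i ∈ s, P i = p) →
        ∑ i ∈ s.erase j, ‖⟪f i, f j⟫_ℂ‖ ≤ (B - 1) / 2 ^ m) ∧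
      (∃ A > (0 : ℝ), ∃ B' > (0 : ℝ), ∀ c : ℕ →₀ ℂ, (∀ k ∈ c.support, P k = p) →
        A * ∑ k ∈ c.support, ‖c k‖ ^ 2 ≤ ‖∑ k ∈ c.support, c k • f k‖ ^ 2 ∧
        ‖∑ k ∈ c.support, c k • f k‖ ^ 2 ≤ B' * ∑ k ∈ c.support, ‖c k‖ ^ 2) := by
  let w : ℕ → ℕ → ℝ := fun i j => if i = j then 0 else ‖⟪f i, f j⟫_ℂ‖
  have hw_erase : ∀ j, ∀ s : Finset ℕ,
      ∑ i ∈ s.erase j, ‖⟪f i, f j⟫_ℂ‖ = ∑ i ∈ s, w i j := by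
    intro j s
    rw [← Finset.sum_erase (f := fun i => w i j) (a := j) s (if_pos rfl)]
    exact Finset.sum_congr rfl fun i hi => (if_neg (Finset.ne_of_mem_erase hi)).symm
  have hself : ∀ j, ‖⟪f j, f j⟫_ℂ‖ = 1 := by
    intro j
    simp [inner_self_eq_norm_sq_to_K, hunit]
  have hrow : ∀ j, ∀ s : Finset ℕ, ∑ i ∈ s, w i j ≤ B - 1 := by
    intro j s
    have h := hSchur j (insert j (s.erase j))
    rw [Finset.sum_insert (Finset.notMem_erase j s), hself] at h
    simp only [norm_inner_symm (f j)] at h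
    rw [hw_erase] at h
    linarith
  obtain ⟨P, hP⟩ := exists_coloring (κ := Fin (2 ^ m)) (w := w)
    (fun i k => by dsimp only [w]; split_ifs <;> positivity)
    (fun i k => by simp only [w, eq_comm (a := i), norm_inner_symm (f i)])
    (fun i => if_pos rfl) hrow
  have hpiece : ∀ p j, P j = p → ∀ s : Finset ℕ, (∀ i ∈ s, P i = p) →
      ∑ i ∈ s.erase j, ‖⟪f i, f j⟫_ℂ‖ ≤ (B - 1) / 2 ^ m := by
    intro p j hj s hs
    have h := hP j s
    rw [Finset.sum_congr rfl fun i hi => if_pos ((hs i hi).trans hj.symm), Fintype.card_fin] at h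
    rw [hw_erase, le_div_iff₀' (by positivity)]
    exact_mod_cast h
  have hδ : 0 ≤ (B - 1) / 2 ^ m := by simpa using hpiece (P 0) 0 rfl ∅
  refine ⟨P, fun p => ⟨hpiece p, 1 - (B - 1) / 2 ^ m, by linarith, 1 + (B - 1) / 2 ^ m,
    by linarith, fun c hc => ?_⟩⟩
  have h := abs_le.1 (abs_norm_sum_smul_sq_sub_le (𝕜 := ℂ) (fun i _ => hunit i)
    (fun j hj => hpiece p j (hc j hj) c.support hc) c)
  constructor <;> linarith [h.1, h.2]
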